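/- Let n ∈ ℕ, a₀, b₀ > 0, T ∈ ℝ, and a > 0. Define A = a₀ − n·a + n·a²·ψ′(a) and B = b₀ + (A − a₀)/a − n·log(a) + n·ψ(a) + T, where ψ and ψ′ are the digamma and trigamma functions. Then (A − 1)/a − B = L′(a) and −(A − 1)/a² = L″(a), where L(a) = n·a·log(a) − n·log Γ(a) − (T+n)·a + (a₀−1)·log(a) − b₀·a; that is, the first and second derivatives of the log of the Gamma(A, B) density agree with those of L at a. -/

import Mathlib

theorem Real.analyticAt_Gamma {x : ℝ} (hx : 0 < x) : AnalyticAt ℝ Real.Gamma x := by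
  have hc : AnalyticAt ℂ Complex.Gamma (x : ℂ) := by
    rw [Complex.analyticAt_iff_eventually_differentiableAt]
    have hopen : IsOpen {z : ℂ | 0 < z.re} := isOpen_lt continuous_const Complex.continuous_re
    filter_upwards [hopen.mem_nhds (show 0 < (x : ℂ).re by simpa using hx)] with z hz
    refine Complex.differentiableAt_Gamma z fun m hm => ?_
    have hre : 0 < z.re := hz
    rw [hm] at hre
    simp only [Complex.neg_re, Complex.natCast_re] at hre
    linarith [(Nat.cast_nonneg m : (0 : ℝ) ≤ m)]
  exact hc.re_ofReal

theorem Real.analyticAt_log_Gamma {x : ℝ} (hx : 0 < x) :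
    AnalyticAt ℝ (fun y : ℝ => Real.log (Real.Gamma y)) x :=
  (Real.analyticAt_Gamma hx).log (Real.Gamma_pos_of_pos hx)

/-- With ψ = (log Γ)′ and ψ′ = (log Γ)″, and A = a₀ − n·a + n·a²·ψ′(a),
    B = b₀ + (A − a₀)/a − n·log a + n·ψ(a) + T (the updates of Algorithm 1):
    the first and second derivatives of the log Gamma(A,B) density match those of
    L(a) = n·a·log a − n·log Γ(a) − (T+n)·a + (a₀−1)·log a − b₀·a at a, i.e.
    (A−1)/a − B = L′(a) and −(A−1)/a² = L″(a). -/
theorem gamma_shape_derivative_matching (n : ℕ) (a0 b0 : ℝ)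
    (ha0 : 0 < a0) (hb0 : 0 < b0) (T : ℝ) (a : ℝ) (ha : 0 < a)
    (ψ ψ' : ℝ → ℝ)
    (hψ : ψ = deriv (fun x : ℝ => Real.log (Real.Gamma x)))
    (hψ' : ψ' = deriv (deriv (fun x : ℝ => Real.log (Real.Gamma x))))
    (A B : ℝ)
    (hA : A = a0 - n * a + n * a ^ 2 * ψ' a)
    (hB : B = b0 + (A - a0) / a - n * Real.log a + n * ψ a + T)
    (L : ℝ → ℝ)
    (hL : L = fun a : ℝ => n * a * Real.log a - n * Real.log (Real.Gamma a)
      - (T + n) * a + (a0 - 1) * Real.log a - b0 * a) :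
    (A - 1) / a - B = deriv L a ∧ -(A - 1) / a ^ 2 = deriv (deriv L) a := by
  have hL₁ : ∀ x : ℝ, 0 < x → HasDerivAt L
      (n * Real.log x - n * ψ x - T + (a0 - 1) * x⁻¹ - b0) x := by
    intro x hx
    have hg := (Real.analyticAt_log_Gamma hx).differentiableAt.hasDerivAt
    have hlog := Real.hasDerivAt_log hx.ne'
    have hid := hasDerivAt_id' x
    rw [hL, hψ]
    refine ((((((hid.const_mul (n : ℝ)).mul hlog).sub (hg.const_mul (n : ℝ))).sub
      (hid.const_mul (T + n))).add (hlog.const_mul (a0 - 1))).sub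
      (hid.const_mul b0)).congr_deriv ?_
    field_simp
    ring
  have hL₂ : HasDerivAt (deriv L) (n * a⁻¹ - n * ψ' a + (a0 - 1) * (-(a ^ 2)⁻¹)) a := by
    have hg : HasDerivAt ψ (ψ' a) a := by
      rw [hψ, hψ']
      exact (Real.analyticAt_log_Gamma ha).deriv.differentiableAt.hasDerivAt
    have h := (((((Real.hasDerivAt_log ha.ne').const_mul (n : ℝ)).sub
      (hg.const_mul (n : ℝ))).sub_const T).add
      ((hasDerivAt_inv ha.ne').const_mul (a0 - 1))).sub_const b0
    refine h.congr_of_eventuallyEq ?_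
    filter_upwards [lt_mem_nhds ha] with x hx
    exact (hL₁ x hx).deriv
  rw [(hL₁ a ha).deriv, hL₂.deriv, hB, hA]
  constructor
  · field_simp
    ring
  · field_simp
    ring
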